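/- Let L > 0 and m ≥ 1. For every smooth L-periodic function f : ℝ² → ℝ, the operator Q_m is positive: ∫_{[0,L]²} (Q_m f) f dμ ≥ 0. -/

import Mathlib

open MeasureTheory

/-- Partial derivative in the `x` direction. -/
noncomputable def px (f : ℝ × ℝ → ℝ) : ℝ × ℝ → ℝ := fun p => fderiv ℝ f p (1, 0)

/-- Partial derivative in the `y` direction. -/
noncomputable def py (f : ℝ × ℝ → ℝ) : ℝ × ℝ → ℝ := fun p => fderiv ℝ f p (0, 1)

/-- The Laplacian `Δf = f_xx + f_yy`. -/
noncomputable def lap (f : ℝ × ℝ → ℝ) : ℝ × ℝ → ℝ := fun p => px (px f) p + py (py f) p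

/-- `D^α = ∂_x^{α₁} ∂_y^{α₂}` for a bi-index `α`. -/
noncomputable def Dop (α : ℕ × ℕ) (f : ℝ × ℝ → ℝ) : ℝ × ℝ → ℝ := px^[α.1] (py^[α.2] f)

/-- The differential operators `Q_m`, defined recursively by `Q₁ = 0` and
`Q_m f = Q_{m−1}((I−Δ)f) − Σ_{|α| ≤ m−2} (−1)^{|α|} D^α D^α Δf` for `m ≥ 2`. -/
noncomputable def Q : ℕ → (ℝ × ℝ → ℝ) → (ℝ × ℝ → ℝ)
  | 0, _ => 0
  | 1, _ => 0
  | (m + 2), f =>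
      Q (m + 1) (fun p => f p - lap f p) -
        fun p =>
          ∑ α ∈ (Finset.range (m + 1) ×ˢ Finset.range (m + 1)).filter
              (fun α : ℕ × ℕ => α.1 + α.2 ≤ m),
            (-1 : ℝ) ^ (α.1 + α.2) * Dop α (Dop α (lap f)) p

/-- `f` is `L`-periodic in both variables. -/
def IsPeriodic (L : ℝ) (f : ℝ × ℝ → ℝ) : Prop :=
  ∀ x y : ℝ, f (x + L, y) = f (x, y) ∧ f (x, y + L) = f (x, y)

/-- The space of smooth `L`-periodic functions. -/
def smoothPeriodic (L : ℝ) : Submodule ℝ (ℝ × ℝ → ℝ) where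
  carrier := {f | ContDiff ℝ (⊤ : ℕ∞) f ∧ IsPeriodic L f}
  add_mem' hf hg := ⟨hf.1.add hg.1, fun x y => by simp [hf.2 x y, hg.2 x y]⟩
  zero_mem' := ⟨contDiff_const, fun _ _ => ⟨rfl, rfl⟩⟩
  smul_mem' c f hf := ⟨contDiff_const.smul hf.1, fun x y => by simp [hf.2 x y]⟩

lemma contDiff_fderiv_apply {f : ℝ × ℝ → ℝ} (hf : ContDiff ℝ (⊤ : ℕ∞) f) (v : ℝ × ℝ) :
    ContDiff ℝ (⊤ : ℕ∞) (fun p => fderiv ℝ f p v) :=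
  (hf.fderiv_right (m := (⊤ : ℕ∞)) (by simp)).clm_apply contDiff_const

lemma IsPeriodic.fderiv_apply {L : ℝ} {f : ℝ × ℝ → ℝ} (hf : IsPeriodic L f) (v : ℝ × ℝ) :
    IsPeriodic L (fun p => fderiv ℝ f p v) := by
  have h₁ : (fun p => f (p + (L, 0))) = f := funext fun p => by
    simpa [Prod.add_def] using (hf p.1 p.2).1
  have h₂ : (fun p => f (p + (0, L))) = f := funext fun p => by
    simpa [Prod.add_def] using (hf p.1 p.2).2
  intro x y
  have e₁ := fderiv_comp_add_right (𝕜 := ℝ) (f := f) (x := (x, y)) (L, 0)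
  have e₂ := fderiv_comp_add_right (𝕜 := ℝ) (f := f) (x := (x, y)) (0, L)
  rw [h₁] at e₁
  rw [h₂] at e₂
  constructor
  · simp [e₁]
  · simp [e₂]

namespace smoothPeriodic

variable {L : ℝ}

lemma differentiable (f : smoothPeriodic L) : Differentiable ℝ (f : ℝ × ℝ → ℝ) :=
  f.2.1.differentiable (by simp)

/-- The derivative in the direction `v`, as an endomorphism of the smooth periodic functions. -/
noncomputable def dirDeriv (v : ℝ × ℝ) : Module.End ℝ (smoothPeriodic L) where
  toFun f := ⟨fun p => fderiv ℝ f p v, contDiff_fderiv_apply f.2.1 v, f.2.2.fderiv_apply v⟩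
  map_add' f g := by
    ext p
    simp [fderiv_add (differentiable f p) (differentiable g p)]
  map_smul' c f := by
    ext p
    simp [fderiv_const_smul (differentiable f p)]

lemma commute_dirDeriv (v w : ℝ × ℝ) :
    Commute (dirDeriv v : Module.End ℝ (smoothPeriodic L)) (dirDeriv w) := by
  ext f p
  have hd : DifferentiableAt ℝ (fderiv ℝ (f : ℝ × ℝ → ℝ)) p :=
    (f.2.1.fderiv_right (m := (⊤ : ℕ∞)) (by simp)).differentiable (by simp) p
  have hs : IsSymmSndFDerivAt ℝ (f : ℝ × ℝ → ℝ) p :=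
    f.2.1.contDiffAt.isSymmSndFDerivAt (by simp; exact WithTop.coe_le_coe.2 le_top)
  change fderiv ℝ (fun q => fderiv ℝ (f : ℝ × ℝ → ℝ) q w) p v =
    fderiv ℝ (fun q => fderiv ℝ (f : ℝ × ℝ → ℝ) q v) p w
  rw [fderiv_clm_apply hd (differentiableAt_const _),
    fderiv_clm_apply hd (differentiableAt_const _)]
  simpa using hs v w

lemma integrableOn (f g : smoothPeriodic L) :
    IntegrableOn (fun p => (f : ℝ × ℝ → ℝ) p * (g : ℝ × ℝ → ℝ) p)
      (Set.Icc 0 L ×ˢ Set.Icc 0 L) :=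
  (f.2.1.continuous.mul g.2.1.continuous).continuousOn.integrableOn_compact
    (isCompact_Icc.prod isCompact_Icc)

/-- The integral of a directional derivative of a periodic function over a period vanishes. -/
lemma integral_fderiv_eq_zero (hL : 0 ≤ L) (h : smoothPeriodic L) (v : ℝ × ℝ) :
    ∫ p in Set.Icc (0 : ℝ) L ×ˢ Set.Icc (0 : ℝ) L, fderiv ℝ (h : ℝ × ℝ → ℝ) p v = 0 := by
  have hc : Continuous (h : ℝ × ℝ → ℝ) := h.2.1.continuous
  have hv (p : ℝ × ℝ) : fderiv ℝ (h : ℝ × ℝ → ℝ) p v =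
      (v.1 • fderiv ℝ (h : ℝ × ℝ → ℝ) p) (1, 0) + (v.2 • fderiv ℝ (h : ℝ × ℝ → ℝ) p) (0, 1) := by
    conv_lhs => rw [show v = v.1 • ((1, 0) : ℝ × ℝ) + v.2 • ((0, 1) : ℝ × ℝ) by ext <;> simp]
    rw [map_add, map_smul, map_smul]
    rfl
  have hcv : Continuous (fun p => fderiv ℝ (h : ℝ × ℝ → ℝ) p v) :=
    (contDiff_fderiv_apply h.2.1 v).continuous
  have key := integral_divergence_prod_Icc_of_hasFDerivAt_off_countable_of_le
    (fun p => v.1 • (h : ℝ × ℝ → ℝ) p) (fun p => v.2 • (h : ℝ × ℝ → ℝ) p)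
    (fun p => v.1 • fderiv ℝ (h : ℝ × ℝ → ℝ) p) (fun p => v.2 • fderiv ℝ (h : ℝ × ℝ → ℝ) p)
    (0, 0) (L, L) ⟨hL, hL⟩ ∅ Set.countable_empty
    (hc.const_smul v.1).continuousOn (hc.const_smul v.2).continuousOn
    (fun p _ => (differentiable h p).hasFDerivAt.const_smul v.1)
    (fun p _ => (differentiable h p).hasFDerivAt.const_smul v.2)
    (by
      simp only [← hv]
      exact hcv.continuousOn.integrableOn_compact isCompact_Icc)
  simp only [← hv] at key
  rw [Set.Icc_prod_Icc, key]
  have h₁ (y : ℝ) : (h : ℝ × ℝ → ℝ) (L, y) = (h : ℝ × ℝ → ℝ) (0, y) := by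
    simpa using (h.2.2 0 y).1
  have h₂ (x : ℝ) : (h : ℝ × ℝ → ℝ) (x, L) = (h : ℝ × ℝ → ℝ) (x, 0) := by
    simpa using (h.2.2 x 0).2
  simp [h₁, h₂]

/-- The `L²` pairing over a period. -/
noncomputable def pairing (f g : smoothPeriodic L) : ℝ :=
  ∫ p in Set.Icc (0 : ℝ) L ×ˢ Set.Icc (0 : ℝ) L, (f : ℝ × ℝ → ℝ) p * (g : ℝ × ℝ → ℝ) p

lemma pairing_add_left (f g h : smoothPeriodic L) :
    pairing (f + g) h = pairing f h + pairing g h := by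
  simp only [pairing, Submodule.coe_add, Pi.add_apply, add_mul]
  exact integral_add (integrableOn f h) (integrableOn g h)

lemma pairing_neg_left (f g : smoothPeriodic L) : pairing (-f) g = -pairing f g := by
  simp [pairing, integral_neg]

/-- Integration by parts. -/
lemma pairing_dirDeriv_left (hL : 0 ≤ L) (v : ℝ × ℝ) (f g : smoothPeriodic L) :
    pairing (dirDeriv v f) g = -pairing f (dirDeriv v g) := by
  have key := integral_fderiv_eq_zero hL
    ⟨fun p => (f : ℝ × ℝ → ℝ) p * (g : ℝ × ℝ → ℝ) p, f.2.1.mul g.2.1,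
      fun x y => by simp [f.2.2 x y, g.2.2 x y]⟩ v
  have hp (p : ℝ × ℝ) :
      fderiv ℝ (fun p => (f : ℝ × ℝ → ℝ) p * (g : ℝ × ℝ → ℝ) p) p v =
        (f : ℝ × ℝ → ℝ) p * (dirDeriv v g : ℝ × ℝ → ℝ) p +
          (dirDeriv v f : ℝ × ℝ → ℝ) p * (g : ℝ × ℝ → ℝ) p := by
    rw [fderiv_fun_mul (differentiable f p) (differentiable g p)]
    simp [dirDeriv, mul_comm]
  simp only [hp] at key
  rw [integral_add (integrableOn f (dirDeriv v g)) (integrableOn (dirDeriv v f) g)] at key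
  unfold pairing
  linarith

/-- Endomorphisms that commute with all directional derivatives and have a nonnegative quadratic
form. -/
structure IsPositiveInvariant (T : Module.End ℝ (smoothPeriodic L)) : Prop where
  commute_dirDeriv : ∀ v, Commute T (dirDeriv v)
  pairing_nonneg : ∀ f, 0 ≤ pairing (T f) f

namespace IsPositiveInvariant

variable {S T : Module.End ℝ (smoothPeriodic L)}

lemma zero : IsPositiveInvariant (0 : Module.End ℝ (smoothPeriodic L)) :=
  ⟨fun _ => Commute.zero_left _, fun f => by simp [pairing]⟩

lemma one : IsPositiveInvariant (1 : Module.End ℝ (smoothPeriodic L)) :=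
  ⟨fun _ => Commute.one_left _, fun _ => integral_nonneg fun _ => mul_self_nonneg _⟩

lemma add (hS : IsPositiveInvariant S) (hT : IsPositiveInvariant T) :
    IsPositiveInvariant (S + T) :=
  ⟨fun v => (hS.commute_dirDeriv v).add_left (hT.commute_dirDeriv v), fun f => by
    rw [LinearMap.add_apply, pairing_add_left]
    exact add_nonneg (hS.pairing_nonneg f) (hT.pairing_nonneg f)⟩

lemma sum {ι : Type*} (s : Finset ι) {T : ι → Module.End ℝ (smoothPeriodic L)}
    (hT : ∀ i ∈ s, IsPositiveInvariant (T i)) : IsPositiveInvariant (∑ i ∈ s, T i) :=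
  Finset.sum_induction T IsPositiveInvariant (fun _ _ => add) zero hT

lemma mul_neg_sq (hL : 0 ≤ L) (hT : IsPositiveInvariant T) (v : ℝ × ℝ) :
    IsPositiveInvariant (T * -(dirDeriv v) ^ 2) := by
  have hc (w : ℝ × ℝ) : Commute (-(dirDeriv v) ^ 2 : Module.End ℝ (smoothPeriodic L))
      (dirDeriv w) := by
    rw [← neg_one_smul ℝ (dirDeriv v ^ 2)]
    exact ((smoothPeriodic.commute_dirDeriv v w).pow_left 2).smul_left _
  refine ⟨fun w => (hT.commute_dirDeriv w).mul_left (hc w), fun f => ?_⟩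
  have h : (T * -(dirDeriv v) ^ 2 : Module.End ℝ (smoothPeriodic L)) f = -dirDeriv v (T (dirDeriv v f)) := by
    have := LinearMap.congr_fun (hT.commute_dirDeriv v).eq (dirDeriv v f)
    simpa [pow_two] using this
  rw [h, pairing_neg_left, pairing_dirDeriv_left hL, neg_neg]
  exact hT.pairing_nonneg _

lemma mul_neg_sq_pow (hL : 0 ≤ L) (hT : IsPositiveInvariant T) (v : ℝ × ℝ) (n : ℕ) :
    IsPositiveInvariant (T * (-(dirDeriv v) ^ 2) ^ n) := by
  induction n with
  | zero => simpa using hT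
  | succ n ih =>
    rw [pow_succ, ← mul_assoc]
    exact ih.mul_neg_sq hL v

end IsPositiveInvariant

/-- The Laplacian on smooth periodic functions. -/
noncomputable def laplacian : Module.End ℝ (smoothPeriodic L) :=
  dirDeriv (1, 0) ^ 2 + dirDeriv (0, 1) ^ 2

lemma coe_laplacian (f : smoothPeriodic L) :
    (laplacian f : ℝ × ℝ → ℝ) = lap f := by
  simp only [laplacian, pow_two]
  rfl

/-- The operator `D^α` on smooth periodic functions. -/
noncomputable def multiDeriv (α : ℕ × ℕ) : Module.End ℝ (smoothPeriodic L) :=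
  dirDeriv (1, 0) ^ α.1 * dirDeriv (0, 1) ^ α.2

lemma coe_multiDeriv (α : ℕ × ℕ) (f : smoothPeriodic L) :
    (multiDeriv α f : ℝ × ℝ → ℝ) = Dop α f := by
  have h₁ : Function.Semiconj (Subtype.val : smoothPeriodic L → ℝ × ℝ → ℝ)
      (dirDeriv (1, 0)) px := fun _ => rfl
  have h₂ : Function.Semiconj (Subtype.val : smoothPeriodic L → ℝ × ℝ → ℝ)
      (dirDeriv (0, 1)) py := fun _ => rfl
  rw [multiDeriv, Module.End.mul_apply, Module.End.pow_apply, Module.End.pow_apply, Dop,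
    (h₁.iterate_right α.1).eq, (h₂.iterate_right α.2).eq]

lemma neg_one_pow_smul_multiDeriv_sq (α : ℕ × ℕ) :
    (-1 : ℝ) ^ (α.1 + α.2) • (multiDeriv α * multiDeriv α : Module.End ℝ (smoothPeriodic L)) =
      (-dirDeriv (1, 0) ^ 2) ^ α.1 * (-dirDeriv (0, 1) ^ 2) ^ α.2 := by
  have hc : Commute (dirDeriv (0, 1) ^ α.2 : Module.End ℝ (smoothPeriodic L))
    (dirDeriv (1, 0) ^ α.1) := (commute_dirDeriv _ _).pow_pow _ _
  have hs (T : Module.End ℝ (smoothPeriodic L)) (n : ℕ) :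
      (-T ^ 2) ^ n = (-1 : ℝ) ^ n • (T ^ n * T ^ n) := by
    rw [← neg_one_smul ℝ (T ^ 2), smul_pow, ← pow_add, ← pow_mul, two_mul]
  rw [multiDeriv, hc.mul_mul_mul_comm, hs, hs, smul_mul_smul_comm, pow_add]

/-- The operator `Q_m` on smooth periodic functions. -/
noncomputable def qOp : ℕ → Module.End ℝ (smoothPeriodic L)
  | 0 => 0
  | 1 => 0
  | (m + 2) =>
      qOp (m + 1) * (1 - laplacian) -
        ∑ α ∈ (Finset.range (m + 1) ×ˢ Finset.range (m + 1)).filter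
            (fun α : ℕ × ℕ => α.1 + α.2 ≤ m),
          (-1 : ℝ) ^ (α.1 + α.2) • (multiDeriv α * multiDeriv α) * laplacian

lemma coe_qOp (m : ℕ) (f : smoothPeriodic L) : (qOp m f : ℝ × ℝ → ℝ) = Q m f := by
  induction m using Nat.twoStepInduction generalizing f with
  | zero => rfl
  | one => rfl
  | more m _ ih =>
    have h : (((1 - laplacian : Module.End ℝ (smoothPeriodic L)) f : smoothPeriodic L) : ℝ × ℝ → ℝ) =
        fun p => (f : ℝ × ℝ → ℝ) p - lap f p := by
      rw [← coe_laplacian]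
      rfl
    rw [Q, ← h, ← ih]
    ext p
    simp [qOp, ← coe_laplacian, ← coe_multiDeriv, LinearMap.sum_apply, Finset.sum_apply]

lemma isPositiveInvariant_qOp (hL : 0 ≤ L) (m : ℕ) :
    IsPositiveInvariant (qOp m : Module.End ℝ (smoothPeriodic L)) := by
  have hlap {T : Module.End ℝ (smoothPeriodic L)} (hT : IsPositiveInvariant T) :
      IsPositiveInvariant (T * -laplacian) := by
    have h : T * -laplacian = T * -dirDeriv (1, 0) ^ 2 + T * -dirDeriv (0, 1) ^ 2 := by
      ext f
      simp [laplacian, add_comm]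
    rw [h]
    exact (hT.mul_neg_sq hL _).add (hT.mul_neg_sq hL _)
  induction m using Nat.twoStepInduction with
  | zero => exact .zero
  | one => exact .zero
  | more m _ ih =>
    have h : (qOp (m + 2) : Module.End ℝ (smoothPeriodic L)) =
        qOp (m + 1) + qOp (m + 1) * -laplacian +
          ∑ α ∈ (Finset.range (m + 1) ×ˢ Finset.range (m + 1)).filter
              (fun α : ℕ × ℕ => α.1 + α.2 ≤ m),
            (-1 : ℝ) ^ (α.1 + α.2) • (multiDeriv α * multiDeriv α) * -laplacian := by
      ext f
      simp [qOp, LinearMap.sum_apply, sub_eq_add_neg]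
    rw [h]
    refine (ih.add (hlap ih)).add (.sum _ fun α _ => ?_)
    rw [neg_one_pow_smul_multiDeriv_sq, ← one_mul ((-dirDeriv (1, 0) ^ 2) ^ α.1)]
    exact hlap ((IsPositiveInvariant.one.mul_neg_sq_pow hL _ _).mul_neg_sq_pow hL _ _)

end smoothPeriodic

/-- `Q_m` is a positive operator on smooth `L`-periodic functions:
`∫ (Q_m f) f ≥ 0` over `[0,L]²`. -/
theorem stmt13 (L : ℝ) (hL : 0 < L) (m : ℕ) (hm : 1 ≤ m)
    (f : ℝ × ℝ → ℝ) (hf : ContDiff ℝ (⊤ : ℕ∞) f) (hfp : IsPeriodic L f) :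
    0 ≤ ∫ p in Set.Icc (0 : ℝ) L ×ˢ Set.Icc (0 : ℝ) L, Q m f p * f p := by
  rw [← smoothPeriodic.coe_qOp m (⟨f, hf, hfp⟩ : smoothPeriodic L)]
  exact (smoothPeriodic.isPositiveInvariant_qOp hL.le m).pairing_nonneg ⟨f, hf, hfp⟩
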